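/- The Jaccard part of the symmetric discordance index satisfies the triangle inequality in the risk functions: for survival data D with |D_ce| ≥ 1 and any risk functions r₁, r₂, r₃ : ℝ^d → ℝ, one has J(r₁, r₃; D) ≤ J(r₁, r₂; D) + J(r₂, r₃; D). -/

import Mathlib

open Finset
open scoped Classical

/-- A survival instance: covariate vector, observation time, and event indicator
(`true` = event observed / non-censored, `false` = censored). -/
structure SurvInstance (d : ℕ) where
  x : Fin d → ℝ
  t : ℝ
  δ : Bool

/-- The non-censored instances of a survival data set. -/
noncomputable def Dev {d : ℕ} (D : Finset (SurvInstance d)) : Finset (SurvInstance d) :=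
  D.filter (fun i => i.δ = true)

/-- The censored instances of a survival data set. -/
noncomputable def Dce {d : ℕ} (D : Finset (SurvInstance d)) : Finset (SurvInstance d) :=
  D.filter (fun i => i.δ = false)

/-- Two risk functions rank the covariates of the instances `i`, `j` strictly oppositely. -/
def Discordant {d : ℕ} (r₁ r₂ : (Fin d → ℝ) → ℝ) (i j : SurvInstance d) : Prop :=
  (r₁ i.x < r₁ j.x ∧ r₂ j.x < r₂ i.x) ∨ (r₁ j.x < r₁ i.x ∧ r₂ i.x < r₂ j.x)

/-- Kendall part of the SDI: the fraction of pairs of distinct non-censored instances that the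
two risk functions rank strictly oppositely (counted over ordered pairs, which gives the same
ratio as over unordered pairs since discordance is symmetric). -/
noncomputable def kendallK {d : ℕ} (r₁ r₂ : (Fin d → ℝ) → ℝ)
    (D : Finset (SurvInstance d)) : ℝ :=
  (((Dev D).offDiag.filter (fun p => Discordant r₁ r₂ p.1 p.2)).card : ℝ) /
    (((Dev D).offDiag.card : ℝ))

/-- Risk set: the non-censored instances that `r` ranks strictly above the covariate vector `x`. -/
noncomputable def riskSet {d : ℕ} (r : (Fin d → ℝ) → ℝ) (D : Finset (SurvInstance d))
    (x : Fin d → ℝ) : Finset (SurvInstance d) :=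
  (Dev D).filter (fun j => r x < r j.x)

/-- Jaccard distance between finite sets, with the convention `0` when the union is empty. -/
noncomputable def jaccardDist {α : Type*} (A B : Finset α) : ℝ :=
  ((symmDiff A B).card : ℝ) / ((A ∪ B).card : ℝ)

/-- Jaccard part of the SDI: the average over censored instances of the Jaccard distance between
the risk sets induced by the two risk functions. -/
noncomputable def jaccardJ {d : ℕ} (r₁ r₂ : (Fin d → ℝ) → ℝ)
    (D : Finset (SurvInstance d)) : ℝ :=
  (∑ i ∈ Dce D, jaccardDist (riskSet r₁ D i.x) (riskSet r₂ D i.x)) / ((Dce D).card : ℝ)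

/-- The weight `α₁ = |D_ev| (|D_ev| - 1) / 2`. -/
noncomputable def alpha1 {d : ℕ} (D : Finset (SurvInstance d)) : ℝ :=
  ((Dev D).card : ℝ) * (((Dev D).card : ℝ) - 1) / 2

/-- The weight `α₂ = |D_ev| ⬝ |D_ce| / 2`. -/
noncomputable def alpha2 {d : ℕ} (D : Finset (SurvInstance d)) : ℝ :=
  ((Dev D).card : ℝ) * ((Dce D).card : ℝ) / 2

/-- The symmetric discordance index. -/
noncomputable def SDI {d : ℕ} (r₁ r₂ : (Fin d → ℝ) → ℝ) (D : Finset (SurvInstance d)) : ℝ :=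
  (alpha1 D / (alpha1 D + alpha2 D)) * kendallK r₁ r₂ D +
    (alpha2 D / (alpha1 D + alpha2 D)) * jaccardJ r₁ r₂ D

theorem jaccardDist_triangle_aux {α : Type*} (A B C : Finset α) :
    jaccardDist A C ≤ jaccardDist A B + jaccardDist B C := by
  have key : ∀ X Y : Finset α, (2 * (X ∪ Y).card : ℝ) = X.card + Y.card + (symmDiff X Y).card := by
    intro X Y
    have h1 := Finset.card_union_add_card_inter X Y
    have h2 : (symmDiff X Y).card + (X ∩ Y).card = (X ∪ Y).card := by
      rw [← Finset.card_union_of_disjoint]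
      · congr 1
        ext z
        simp only [Finset.mem_union, Finset.mem_symmDiff, Finset.mem_inter]
        tauto
      · rw [Finset.disjoint_left]
        intro z
        simp only [Finset.mem_symmDiff, Finset.mem_inter]
        tauto
    have h3 : 2 * (X ∪ Y).card = X.card + Y.card + (symmDiff X Y).card := by omega
    exact_mod_cast h3
  have bd : ∀ X Y : Finset α, (X.card : ℝ) ≤ Y.card + (symmDiff X Y).card := by
    intro X Y
    have h : X ⊆ Y ∪ symmDiff X Y := by
      intro z
      simp only [Finset.mem_union, Finset.mem_symmDiff]
      tauto
    exact_mod_cast (Finset.card_le_card h).trans (Finset.card_union_le _ _)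
  have tri : ((symmDiff A C).card : ℝ) ≤ (symmDiff A B).card + (symmDiff B C).card := by
    have h : symmDiff A C ⊆ symmDiff A B ∪ symmDiff B C := by
      intro z
      simp only [Finset.mem_union, Finset.mem_symmDiff]
      tauto
    exact_mod_cast (Finset.card_le_card h).trans (Finset.card_union_le _ _)
  have low : ∀ (X Y : Finset α) (T : ℝ), 2 * ((X ∪ Y).card : ℝ) ≤ T →
      2 * ((symmDiff X Y).card : ℝ) / T ≤ jaccardDist X Y := by
    intro X Y T hT
    unfold jaccardDist
    have hk := key X Y
    have x0 : (0 : ℝ) ≤ X.card := Nat.cast_nonneg _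
    have y0 : (0 : ℝ) ≤ Y.card := Nat.cast_nonneg _
    have s0 : (0 : ℝ) ≤ (symmDiff X Y).card := Nat.cast_nonneg _
    have u0 : (0 : ℝ) ≤ (X ∪ Y).card := Nat.cast_nonneg _
    rcases u0.eq_or_lt with hu | hu
    · have : ((symmDiff X Y).card : ℝ) = 0 := by linarith
      simp [this]
    · rw [div_le_div_iff₀ (by linarith) hu]
      nlinarith
  have hAC := key A C
  have hAB := key A B
  have hBC := key B C
  have b1 := bd B C
  have b2 := bd B A
  rw [symmDiff_comm B A] at b2
  have a0 : (0 : ℝ) ≤ A.card := Nat.cast_nonneg _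
  have c0 : (0 : ℝ) ≤ C.card := Nat.cast_nonneg _
  have s0 : (0 : ℝ) ≤ (symmDiff A C).card := Nat.cast_nonneg _
  have u0 : (0 : ℝ) ≤ (A ∪ C).card := Nat.cast_nonneg _
  have l1 := low A B (A.card + C.card + (symmDiff A B).card + (symmDiff B C).card) (by linarith)
  have l2 := low B C (A.card + C.card + (symmDiff A B).card + (symmDiff B C).card) (by linarith)
  refine le_trans ?_ (add_le_add l1 l2)
  rw [← add_div]
  unfold jaccardDist
  rcases u0.eq_or_lt with hu | hu
  · rw [← hu, div_zero]
    positivity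
  · rw [div_le_div_iff₀ hu (by linarith)]
    nlinarith [mul_le_mul_of_nonneg_right tri (add_nonneg a0 c0)]

/-- The Jaccard part of the symmetric discordance index satisfies the
triangle inequality in the risk functions. -/
theorem jaccardJ_triangle {d : ℕ} (D : Finset (SurvInstance d))
    (hinj : Set.InjOn (fun i : SurvInstance d => i.x) ↑D)
    (hce : 1 ≤ (Dce D).card)
    (r₁ r₂ r₃ : (Fin d → ℝ) → ℝ) :
    jaccardJ r₁ r₃ D ≤ jaccardJ r₁ r₂ D + jaccardJ r₂ r₃ D := by
  unfold jaccardJ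
  rw [← add_div, ← Finset.sum_add_distrib]
  refine div_le_div_of_nonneg_right ?_ (Nat.cast_nonneg _)
  exact Finset.sum_le_sum fun i _ => jaccardDist_triangle_aux _ _ _
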